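/- arXiv:0806.0281 — 3 statements merged into one kernel-verified Lean document; each statement's English description precedes it below -/
import Mathlib

section
/- For all integers k ≥ 0 and k+1 ≤ s ≤ n, the number of k-flaw preference sets of length n+1 (with n+1 spaces), entries at most s and first entry s equals the number of k-flaw preference sets of length n (with n spaces) with entries at most s: p^s_{n+1;≤s;k} = p_{n;≤s;k}. -/
/-- One parking step: a car with preference `a` parks in the first unoccupied
space `j` with `a ≤ j ≤ m`, if such a space exists; otherwise it leaves. -/
def parkStep (m : ℕ) (occ : Finset ℕ) (a : ℕ) : Finset ℕ :=
  if h : ((Finset.Icc a m) \ occ).Nonempty then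
    insert (((Finset.Icc a m) \ occ).min' h) occ
  else occ

/-- The set of occupied spaces after the cars with preference list `l`
(in order of arrival) have tried to park among spaces `1, …, m`. -/
def occupied (m : ℕ) (l : List ℕ) : Finset ℕ := l.foldl (parkStep m) ∅

/-- The number of cars that leave unparked. -/
def flaws (m : ℕ) (l : List ℕ) : ℕ := l.length - (occupied m l).card

/-- The preference list (with entries in `[1, s]`) encoded by a function `Fin n → Fin s`. -/
def prefList {n s : ℕ} (f : Fin n → Fin s) : List ℕ :=
  (List.ofFn f).map (fun i => (i : ℕ) + 1)

/-- `p n m s k` is the number of `k`-flaw preference sets of length `n` with `m`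
parking spaces, all of whose entries are at most `s`. -/
def p (n m s k : ℕ) : ℕ :=
  (Finset.univ.filter (fun f : Fin n → Fin s => flaws m (prefList f) = k)).card

/-- `pL n m s k l` is the number of `k`-flaw preference sets of length `n` with `m`
parking spaces, entries at most `s`, and first entry `l`. -/
def pL (n m s k l : ℕ) : ℕ :=
  (Finset.univ.filter (fun f : Fin n → Fin s =>
    flaws m (prefList f) = k ∧ (prefList f).head? = some l)).card

/-- The set of empty spaces. -/
def empties (m : ℕ) (l : List ℕ) : Finset ℕ := Finset.Icc 1 m \ occupied m l

/-- `n_α`: the number of entries equal to the first entry. -/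
def nstat (l : List ℕ) : ℕ := l.count l.headI

/-- `h_α`: the number of empty spaces smaller than the first entry. -/
def hstat (m : ℕ) (l : List ℕ) : ℕ := ((empties m l).filter (fun x => x < l.headI)).card

/-- `τ_α`: the number of entries smaller than the first entry, plus one. -/
def taustat (l : List ℕ) : ℕ := l.countP (fun a => a < l.headI) + 1

/-- `m_α`: the largest empty space. -/
def mstat (m : ℕ) (l : List ℕ) : ℕ := (empties m l).sup id

/-- The order embedding of `ℕ` that skips the value `s`. -/
def skip (s j : ℕ) : ℕ := if j < s then j else j + 1

lemma skip_mono (s : ℕ) : Monotone (skip s) := by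
  intro a b h
  unfold skip
  split_ifs <;> omega

lemma skip_inj (s : ℕ) : Function.Injective (skip s) := by
  intro a b h
  unfold skip at h
  split_ifs at h <;> omega

lemma skip_ne (s j : ℕ) : skip s j ≠ s := by
  unfold skip
  split_ifs <;> omega

lemma free_eq (n s a : ℕ) (occ : Finset ℕ) (ha : a ≤ s) (hs : s ≤ n + 1) :
    Finset.Icc a (n + 1) \ insert s (occ.image (skip s)) =
      (Finset.Icc a n \ occ).image (skip s) := by
  ext x
  simp only [Finset.mem_sdiff, Finset.mem_Icc, Finset.mem_insert, Finset.mem_image, not_or,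
    not_exists, not_and]
  constructor
  · rintro ⟨⟨h1, h2⟩, h3, h4⟩
    by_cases hx : x < s
    · have e : skip s x = x := by simp [skip, hx]
      exact ⟨x, ⟨⟨h1, by omega⟩, fun h => h4 x h e⟩, e⟩
    · have e : skip s (x - 1) = x := by
        unfold skip
        split_ifs <;> omega
      exact ⟨x - 1, ⟨⟨by omega, by omega⟩, fun h => h4 _ h e⟩, e⟩
  · rintro ⟨y, ⟨⟨h1, h2⟩, h3⟩, rfl⟩
    refine ⟨?_, skip_ne s y, ?_⟩
    · unfold skip
      split_ifs <;> omega
    · intro z hz hzy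
      exact h3 (skip_inj s hzy ▸ hz)

lemma step_eq (n s a : ℕ) (occ : Finset ℕ) (ha : a ≤ s) (hs : s ≤ n + 1) :
    parkStep (n + 1) (insert s (occ.image (skip s))) a =
      insert s ((parkStep n occ a).image (skip s)) := by
  unfold parkStep
  simp only [free_eq n s a occ ha hs, Finset.image_nonempty]
  split_ifs with h
  · rw [Finset.min'_image (skip_mono s), Finset.image_insert, Finset.insert_comm]
  · rfl

lemma foldl_eq (n s : ℕ) (hs : s ≤ n + 1) (l : List ℕ) (hl : ∀ a ∈ l, a ≤ s) :
    ∀ occ : Finset ℕ, l.foldl (parkStep (n + 1)) (insert s (occ.image (skip s))) =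
      insert s ((l.foldl (parkStep n) occ).image (skip s)) := by
  induction l with
  | nil => intro occ; rfl
  | cons a l ih =>
    intro occ
    simp only [List.foldl_cons]
    rw [step_eq n s a occ (hl a (by simp)) hs]
    exact ih (fun b hb => hl b (by simp [hb])) _

lemma first_step (n s : ℕ) (hs : s ≤ n + 1) : parkStep (n + 1) ∅ s = {s} := by
  have hne : (Finset.Icc s (n + 1) \ ∅).Nonempty := ⟨s, by simp [hs]⟩
  unfold parkStep
  rw [dif_pos hne]
  have : (Finset.Icc s (n + 1) \ ∅).min' hne = s := by
    apply le_antisymm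
    · exact Finset.min'_le _ _ (by simp [hs])
    · have h := Finset.min'_mem _ hne
      simp only [Finset.mem_sdiff, Finset.mem_Icc] at h
      exact h.1.1
  rw [this]
  rfl

lemma flaws_cons (n s : ℕ) (hs : s ≤ n + 1) (l : List ℕ) (hl : ∀ a ∈ l, a ≤ s) :
    flaws (n + 1) (s :: l) = flaws n l := by
  have h := foldl_eq n s hs l hl ∅
  have hc : occupied (n + 1) (s :: l) = insert s ((occupied n l).image (skip s)) := by
    unfold occupied
    rw [List.foldl_cons, first_step n s hs, ← h]
    rfl
  unfold flaws
  rw [hc, Finset.card_insert_of_notMem, Finset.card_image_of_injective _ (skip_inj s)]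
  · simp
  · simp [skip_ne]

lemma prefList_cons {n s : ℕ} (a : Fin s) (f : Fin n → Fin s) :
    prefList (Fin.cons a f : Fin (n + 1) → Fin s) = ((a : ℕ) + 1) :: prefList f := by
  simp [prefList, List.ofFn_succ]

lemma prefList_le {n s : ℕ} (f : Fin n → Fin s) : ∀ a ∈ prefList f, a ≤ s := by
  intro a ha
  simp [prefList, List.mem_ofFn] at ha
  obtain ⟨j, rfl⟩ := ha
  exact (f j).2

/-- Theorem 6.4: `p^s_{n+1;≤s;k} = p_{n;≤s;k}` for `k ≥ 0` and `k+1 ≤ s ≤ n`. -/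
theorem stmt11 (n s k : ℕ) (hs1 : k + 1 ≤ s) (hsn : s ≤ n) :
    pL (n + 1) (n + 1) s k s = p n n s k := by
  obtain ⟨t, rfl⟩ : ∃ t, s = t + 1 := ⟨s - 1, by omega⟩
  have key : ∀ g : Fin n → Fin (t + 1),
      prefList (Fin.cons (Fin.last t) g : Fin (n + 1) → Fin (t + 1)) =
        (t + 1) :: prefList g := by
    intro g
    rw [prefList_cons]
    simp
  unfold pL p
  symm
  apply Finset.card_bij
    (fun g _ => (Fin.cons (Fin.last t) g : Fin (n + 1) → Fin (t + 1)))
  · intro g hg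
    simp only [Finset.mem_filter, Finset.mem_univ, true_and] at hg ⊢
    rw [key, flaws_cons n (t + 1) (by omega) _ (prefList_le g)]
    exact ⟨hg, rfl⟩
  · intro g _ g' _ h
    exact Fin.cons_right_injective (α := fun _ => Fin (t + 1)) _ h
  · intro f hf
    simp only [Finset.mem_filter, Finset.mem_univ, true_and] at hf
    obtain ⟨a, g, rfl⟩ : ∃ (a : Fin (t + 1)) (g : Fin n → Fin (t + 1)),
        f = (Fin.cons a g : Fin (n + 1) → Fin (t + 1)) :=
      ⟨f 0, Fin.tail f, (Fin.cons_self_tail f).symm⟩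
    have ha : a = Fin.last t := by
      have h := hf.2
      rw [prefList_cons] at h
      simp only [List.head?_cons, Option.some.injEq] at h
      apply Fin.ext
      simp only [Fin.val_last]
      omega
    subst ha
    refine ⟨g, ?_, rfl⟩
    simp only [Finset.mem_filter, Finset.mem_univ, true_and]
    rw [← flaws_cons n (t + 1) (by omega) _ (prefList_le g), ← key]
    exact hf.1
end

section
/- For all integers k ≥ 1 and k+2 ≤ s ≤ n, the number of k-flaw preference sets of length n+1 (with n+1 spaces), entries at most s and first entry 1 equals the number of (k+1)-flaw preference sets of length n (with n spaces) with entries at most s: p^1_{n+1;≤s;k} = p_{n;≤s;k+1}. -/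
lemma prefList_eq {n s : ℕ} (f : Fin n → Fin s) :
    prefList f = List.ofFn (fun i => (f i : ℕ) + 1) := by
  unfold prefList
  have h : ∀ l : List (Fin s), (do let a ← l; pure (a : ℕ) : List ℕ) = 
      l.map (fun a : Fin s => (a : ℕ)) := by
    intro l
    induction l with
    | nil => rfl
    | cons a l ih => simp_all
  rw [h, List.map_map, List.map_ofFn]
  rfl

lemma occ_append (m : ℕ) (l : List ℕ) (a : ℕ) :
    occupied m (l ++ [a]) = parkStep m (occupied m l) a := by
  simp [occupied, List.foldl_append]

/-- Either the car parks at `c`, the least free space from `a` on, or all of `[a, m]` is full. -/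
lemma step_cases (m : ℕ) (o : Finset ℕ) (a : ℕ) :
    (∃ c, a ≤ c ∧ c ≤ m ∧ c ∉ o ∧ (∀ d, a ≤ d → d ≤ m → d ∉ o → c ≤ d) ∧
      parkStep m o a = insert c o) ∨
    ((∀ d, a ≤ d → d ≤ m → d ∈ o) ∧ parkStep m o a = o) := by
  unfold parkStep
  split_ifs with h
  · left
    have h1 := Finset.min'_mem _ h
    rw [Finset.mem_sdiff, Finset.mem_Icc] at h1
    refine ⟨_, h1.1.1, h1.1.2, h1.2, ?_, rfl⟩
    intro d h2 h3 h4
    apply Finset.min'_le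
    simp [h2, h3, h4]
  · right
    refine ⟨?_, rfl⟩
    intro d h2 h3
    by_contra h4
    exact h ⟨d, by simp [h2, h3, h4]⟩

lemma occ_inv (m : ℕ) (l : List ℕ) (hl : ∀ a ∈ l, 1 ≤ a) :
    (∀ x ∈ occupied m l, 1 ≤ x ∧ x ≤ m) ∧
    (∀ j, ((occupied m l).filter (· ≤ j)).card ≤ l.countP (· ≤ j)) ∧
    (∀ e, e ≤ m → e ∉ occupied m l →
      ((occupied m l).filter (· ≤ e)).card = l.countP (· ≤ e)) := by
  induction l using List.reverseRecOn with
  | nil => simp [occupied]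
  | append_singleton l a ih =>
    obtain ⟨i1, i2, i3⟩ := ih (fun x hx => hl x (by simp [hx]))
    have ha : 1 ≤ a := hl a (by simp)
    rw [occ_append]
    rcases step_cases m (occupied m l) a with ⟨c, c1, c2, c3, c4, c5⟩ | ⟨c1, c2⟩
    · rw [c5]
      refine ⟨?_, ?_, ?_⟩
      · intro x hx
        rcases Finset.mem_insert.1 hx with rfl | hx
        · omega
        · exact i1 x hx
      · intro j
        have := i2 j
        rw [Finset.filter_insert, List.countP_append]
        split_ifs with h
        · rw [Finset.card_insert_of_notMem (by simp [c3])]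
          have : a ≤ j := by omega
          simp [this]; omega
        · omega
      · intro e he he'
        rw [Finset.mem_insert, not_or] at he'
        have := i3 e he he'.2
        rw [Finset.filter_insert, List.countP_append]
        by_cases hae : a ≤ e
        · have := c4 e hae he he'.2
          rw [if_pos this, Finset.card_insert_of_notMem (by simp [c3])]
          simp [hae]; omega
        · rw [if_neg (by omega)]
          simp [hae]; omega
    · rw [c2]
      refine ⟨i1, ?_, ?_⟩
      · intro j
        have := i2 j
        rw [List.countP_append]; omega
      · intro e he he'
        have h3 := i3 e he he'
        have : ¬ a ≤ e := fun h => he' (c1 e h he)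
        rw [List.countP_append]
        simp [this]; omega

lemma flaws_upper (m : ℕ) (l : List ℕ) (hl : ∀ a ∈ l, 1 ≤ a) (hm : l.length = m)
    (j : ℕ) (hj : j ≤ m) : j ≤ flaws m l + l.countP (· ≤ j) := by
  obtain ⟨i1, i2, -⟩ := occ_inv m l hl
  have h2 := i2 j
  have h3 := Finset.card_filter_add_card_filter_not (s := occupied m l) (· ≤ j)
  have h4 : ((occupied m l).filter (fun x => ¬ x ≤ j)).card ≤ (Finset.Ioc j m).card := by
    apply Finset.card_le_card
    intro x hx
    rw [Finset.mem_filter] at hx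
    have := i1 x hx.1
    rw [Finset.mem_Ioc]; omega
  rw [Nat.card_Ioc] at h4
  unfold flaws
  omega

lemma flaws_attained (m : ℕ) (l : List ℕ) (hl : ∀ a ∈ l, 1 ≤ a) (hm : l.length = m)
    (hF : 1 ≤ flaws m l) : ∃ e, 1 ≤ e ∧ e ≤ m ∧ flaws m l + l.countP (· ≤ e) = e := by
  obtain ⟨i1, -, i3⟩ := occ_inv m l hl
  have hne : (Finset.Icc 1 m \ occupied m l).Nonempty := by
    rw [← Finset.card_pos]
    have := Finset.le_card_sdiff (occupied m l) (Finset.Icc 1 m)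
    rw [Nat.card_Icc] at this
    unfold flaws at hF
    omega
  have he := Finset.max'_mem _ hne
  have hmax : ∀ x ∈ Finset.Icc 1 m \ occupied m l,
      x ≤ (Finset.Icc 1 m \ occupied m l).max' hne := fun x hx => Finset.le_max' _ x hx
  generalize (Finset.Icc 1 m \ occupied m l).max' hne = e at he hmax
  rw [Finset.mem_sdiff, Finset.mem_Icc] at he
  refine ⟨e, he.1.1, he.1.2, ?_⟩
  have h2 := i3 e he.1.2 he.2
  have h3 := Finset.card_filter_add_card_filter_not (s := occupied m l) (· ≤ e)
  have h4 : (occupied m l).filter (fun x => ¬ x ≤ e) = Finset.Ioc e m := by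
    ext x
    rw [Finset.mem_filter, Finset.mem_Ioc]
    constructor
    · rintro ⟨h, h'⟩
      have := i1 x h
      omega
    · rintro ⟨h, h'⟩
      refine ⟨?_, by omega⟩
      by_contra hx
      have := hmax x (by rw [Finset.mem_sdiff, Finset.mem_Icc]; exact ⟨by omega, hx⟩)
      omega
  rw [h4, Nat.card_Ioc] at h3
  have := he.1.2
  unfold flaws at hF ⊢
  omega

lemma flaws_cons_s12 (n k : ℕ) (hk : 1 ≤ k) (b : List ℕ) (hb : ∀ a ∈ b, 1 ≤ a ∧ a ≤ n)
    (hn : b.length = n) : flaws (n + 1) (1 :: b) = k ↔ flaws n b = k + 1 := by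
  have hb1 : ∀ a ∈ b, 1 ≤ a := fun a h => (hb a h).1
  have hb2 : ∀ a ∈ 1 :: b, 1 ≤ a := by simpa using hb1
  have hcount : ∀ j, 1 ≤ j → (1 :: b).countP (· ≤ j) = b.countP (· ≤ j) + 1 := by
    intro j hj
    rw [List.countP_cons_of_pos (by simpa using hj)]
  have A : 1 ≤ flaws (n + 1) (1 :: b) → flaws (n + 1) (1 :: b) + 1 ≤ flaws n b := by
    intro h
    obtain ⟨e, e1, e2, e3⟩ := flaws_attained (n + 1) (1 :: b) hb2 (by simp [hn]) h
    rw [hcount e e1] at e3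
    have : e ≤ n := by
      by_contra hne
      have : b.countP (· ≤ e) = b.length := by
        rw [List.countP_eq_length]
        intro a ha
        have := (hb a ha).2
        simp; omega
      omega
    have := flaws_upper n b hb1 hn e this
    omega
  have B : 1 ≤ flaws n b → flaws n b ≤ flaws (n + 1) (1 :: b) + 1 := by
    intro h
    obtain ⟨e, e1, e2, e3⟩ := flaws_attained n b hb1 hn h
    have := flaws_upper (n + 1) (1 :: b) hb2 (by simp [hn]) e (by omega)
    rw [hcount e e1] at this
    omega
  omega

/-- Corollary 6.1: `p^1_{n+1;≤s;k} = p_{n;≤s;k+1}` for `k ≥ 1` and `k+2 ≤ s ≤ n`. -/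
theorem stmt12 (n s k : ℕ) (hk : 1 ≤ k) (hs1 : k + 2 ≤ s) (hsn : s ≤ n) :
    pL (n + 1) (n + 1) s k 1 = p n n s (k + 1) := by
  obtain ⟨t, rfl⟩ : ∃ t, s = t + 1 := ⟨s - 1, by omega⟩
  have hc : ∀ b : Fin n → Fin (t + 1),
      prefList (Fin.cons 0 b : Fin (n + 1) → Fin (t + 1)) = 1 :: prefList b := by
    intro b
    simp [prefList_eq, List.ofFn_succ]
  have hfl : ∀ b : Fin n → Fin (t + 1),
      flaws (n + 1) (1 :: prefList b) = k ↔ flaws n (prefList b) = k + 1 := by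
    intro b
    apply flaws_cons_s12 n k hk
    · intro a ha
      rw [prefList_eq, List.mem_ofFn] at ha
      obtain ⟨i, rfl⟩ := ha
      have := (b i).2
      omega
    · simp [prefList_eq]
  unfold pL p
  symm
  apply Finset.card_bij (fun b _ => (Fin.cons 0 b : Fin (n + 1) → Fin (t + 1)))
  · intro b hb
    simp only [Finset.mem_filter, Finset.mem_univ, true_and] at hb ⊢
    rw [hc, hfl]
    exact ⟨hb, rfl⟩
  · intro b _ b' _ h
    exact Fin.cons_right_injective (α := fun _ => Fin (t + 1)) _ h
  · intro f hf
    simp only [Finset.mem_filter, Finset.mem_univ, true_and] at hf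
    have h0 : f 0 = 0 := by
      have := hf.2
      simpa [prefList_eq, List.ofFn_succ] using this
    have hf' : (Fin.cons 0 (Fin.tail f) : Fin (n + 1) → Fin (t + 1)) = f := by
      rw [← h0]; exact Fin.cons_self_tail f
    refine ⟨Fin.tail f, ?_, hf'⟩
    simp only [Finset.mem_filter, Finset.mem_univ, true_and]
    rw [← hfl, ← hc, hf']
    exact hf.1
end

section
/- For every integer n ≥ 2, the number of 1-flaw preference sets of length n (with n spaces, entries at most n) whose first entry is n equals the number of parking functions of length n whose first entry is 2: p^n_{n;1} = p^2_n. -/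
theorem aux_occ_sub (m : ℕ) (l : List ℕ) (hl : ∀ a ∈ l, 1 ≤ a) :
    occupied m l ⊆ Finset.Icc 1 m := by
  induction l using List.reverseRecOn with
  | nil => simp [occupied]
  | append_singleton l a ih =>
    have ih := ih (fun x hx => hl x (by simp [hx]))
    have ha : 1 ≤ a := hl a (by simp)
    have e : occupied m (l ++ [a]) = parkStep m (occupied m l) a := by simp [occupied]
    rw [e, parkStep]
    split_ifs with h
    · have := Finset.min'_mem _ h
      simp only [Finset.mem_sdiff, Finset.mem_Icc] at this
      intro x hx
      rcases Finset.mem_insert.1 hx with rfl | hx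
      · simp only [Finset.mem_Icc]; omega
      · exact ih hx
    · exact ih

theorem aux_upper (m i : ℕ) (l : List ℕ) :
    ((occupied m l).filter (fun x => x ≤ i)).card ≤ l.countP (fun a => a ≤ i) := by
  induction l using List.reverseRecOn with
  | nil => simp [occupied]
  | append_singleton l a ih =>
    have e : occupied m (l ++ [a]) = parkStep m (occupied m l) a := by simp [occupied]
    rw [e, parkStep, List.countP_append]
    split_ifs with h
    · have hm := Finset.min'_mem _ h
      simp only [Finset.mem_sdiff, Finset.mem_Icc] at hm
      rw [Finset.filter_insert]
      split_ifs with h2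
      · have : a ≤ i := by omega
        have h3 := Finset.card_insert_le (((Finset.Icc a m) \ occupied m l).min' h)
          ((occupied m l).filter (fun x => x ≤ i))
        simp only [List.countP_singleton, this, decide_true, if_true]
        omega
      · omega
    · omega

theorem aux_lower (m i : ℕ) (him : i ≤ m) (l : List ℕ) (hi : i ∉ occupied m l) :
    l.countP (fun a => a ≤ i) ≤ ((occupied m l).filter (fun x => x ≤ i)).card := by
  induction l using List.reverseRecOn with
  | nil => simp
  | append_singleton l a ih =>
    have e : occupied m (l ++ [a]) = parkStep m (occupied m l) a := by simp [occupied]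
    rw [e, parkStep] at hi
    rw [e, parkStep, List.countP_append]
    split_ifs at hi ⊢ with h
    · have hi2 : i ∉ occupied m l := fun h => hi (Finset.mem_insert_of_mem h)
      have ih := ih hi2
      have hm := Finset.min'_mem _ h
      simp only [Finset.mem_sdiff, Finset.mem_Icc] at hm
      by_cases ha : a ≤ i
      · have hle : ((Finset.Icc a m) \ occupied m l).min' h ≤ i :=
          Finset.min'_le _ _ (by simp [ha, him, hi2])
        rw [Finset.filter_insert, if_pos hle, Finset.card_insert_of_notMem
          (fun hx => hm.2 (Finset.mem_filter.1 hx).1)]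
        simp only [List.countP_singleton, ha, decide_true, if_true]
        omega
      · simp only [List.countP_singleton, ha, decide_false]
        refine le_trans ?_ (Finset.card_le_card
          (Finset.filter_subset_filter _ (Finset.subset_insert _ _)))
        simpa using ih
    · have ih := ih hi
      have ha : ¬ a ≤ i := fun ha => h ⟨i, by simp [ha, him, hi]⟩
      simpa [ha] using ih

theorem aux_crit (n k : ℕ) (l : List ℕ) (hlen : l.length = n) (hl : ∀ a ∈ l, 1 ≤ a) :
    flaws n l ≤ k ↔ ∀ i ≤ n, i ≤ l.countP (fun a => a ≤ i) + k := by
  have hsub := aux_occ_sub n l hl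
  have hcard : (occupied n l).card ≤ n := by
    simpa using Finset.card_le_card hsub
  -- splitting the occupied set at i
  have hsplit : ∀ i, (occupied n l).card = ((occupied n l).filter (fun x => x ≤ i)).card
      + ((occupied n l).filter (fun x => ¬ x ≤ i)).card := fun i =>
    (Finset.card_filter_add_card_filter_not _).symm
  rw [flaws, hlen]
  constructor
  · intro h i hi
    have h1 := aux_upper n i l
    have h2 := hsplit i
    have h3 : ((occupied n l).filter (fun x => ¬ x ≤ i)).card ≤ n - i := by
      have : (occupied n l).filter (fun x => ¬ x ≤ i) ⊆ Finset.Ioc i n := by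
        intro x hx
        have hx := Finset.mem_filter.1 hx
        have := Finset.mem_Icc.1 (hsub hx.1)
        simp only [Finset.mem_Ioc]; omega
      simpa using Finset.card_le_card this
    omega
  · intro h
    by_cases hE : (Finset.Icc 1 n \ occupied n l).Nonempty
    · obtain ⟨i, hi⟩ : ∃ i, i = (Finset.Icc 1 n \ occupied n l).max' hE := ⟨_, rfl⟩
      have hm := Finset.max'_mem _ hE
      rw [← hi] at hm
      simp only [Finset.mem_sdiff, Finset.mem_Icc] at hm
      have h1 := aux_lower n i hm.1.2 l hm.2
      have h2 := hsplit i
      have h3 : n - i ≤ ((occupied n l).filter (fun x => ¬ x ≤ i)).card := by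
        have : Finset.Ioc i n ⊆ (occupied n l).filter (fun x => ¬ x ≤ i) := by
          intro x hx
          have hx := Finset.mem_Ioc.1 hx
          refine Finset.mem_filter.2 ⟨?_, by omega⟩
          by_contra hc
          have := Finset.le_max' (Finset.Icc 1 n \ occupied n l) x
            (by simp only [Finset.mem_sdiff, Finset.mem_Icc]; exact ⟨by omega, hc⟩)
          omega
        simpa using Finset.card_le_card this
      have := h i hm.1.2
      omega
    · have : Finset.Icc 1 n ⊆ occupied n l := by
        rw [Finset.not_nonempty_iff_eq_empty, Finset.sdiff_eq_empty_iff_subset] at hE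
        exact hE
      have := Finset.card_le_card this
      simp at this
      omega

theorem aux_pL (m k : ℕ) (x : Fin (m + 1)) :
    pL (m + 1) (m + 1) (m + 1) k (x + 1) =
      (Finset.univ.filter (fun g : Fin m → Fin (m + 1) =>
        flaws (m + 1) ((x + 1 : ℕ) :: prefList g) = k)).card := by
  have hc : ∀ (y : Fin (m + 1)) (g : Fin m → Fin (m + 1)),
      prefList (Fin.cons y g : Fin (m + 1) → Fin (m + 1)) = (y + 1 : ℕ) :: prefList g := by
    intro y g
    simp [prefList, List.ofFn_succ]
  symm
  unfold pL
  refine Finset.card_bij (fun g _ => (Fin.cons x g : Fin (m + 1) → Fin (m + 1))) ?_ ?_ ?_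
  · intro g hg
    simp only [Finset.mem_filter, Finset.mem_univ, true_and] at hg ⊢
    rw [hc]
    exact ⟨hg, rfl⟩
  · intro g _ g' _ h
    exact (Fin.cons_injective2 h).2
  · intro f hf
    simp only [Finset.mem_filter, Finset.mem_univ, true_and] at hf
    have hf0 : f = Fin.cons (f 0) (Fin.tail f) := (Fin.cons_self_tail f).symm
    rw [hf0, hc] at hf
    have hx : f 0 = x := by
      have := hf.2
      simp at this
      exact Fin.ext this
    rw [hx] at hf hf0
    exact ⟨Fin.tail f, by simpa using hf.1, hf0.symm⟩

def cnt {m : ℕ} (g : Fin m → Fin (m + 1)) (i : ℕ) : ℕ :=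
  (prefList g).countP (fun a => a ≤ i)

theorem pref_eq {m s : ℕ} (g : Fin m → Fin s) :
    prefList g = List.ofFn (fun j => (g j : ℕ) + 1) := by
  have h : ∀ l : List (Fin s), (do let a ← l; pure (a : ℕ)) = l.map (fun a : Fin s => (a : ℕ)) := by
    intro l
    induction l with
    | nil => rfl
    | cons a l ih => simpa using ih
  unfold prefList
  rw [h, List.map_map, List.map_ofFn]
  rfl

theorem len_pref {m s : ℕ} (g : Fin m → Fin s) : (prefList g).length = m := by
  simp [pref_eq]

theorem mem_pref {m s : ℕ} (g : Fin m → Fin s) (a : ℕ) :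
    a ∈ prefList g ↔ ∃ j, (g j : ℕ) + 1 = a := by
  simp [prefList, List.mem_ofFn]

theorem aux_shift {m : ℕ} (g : Fin m → Fin (m + 1)) (h : ∀ j, (g j : ℕ) ≠ m) (i : ℕ) :
    cnt (fun j => g j + 1) (i + 1) = cnt g i := by
  have : prefList (fun j => g j + 1) = (prefList g).map (· + 1) := by
    simp only [pref_eq, List.map_ofFn]
    congr 1
    funext j
    have hl : g j < Fin.last m := by
      have := h j
      have := (g j).isLt
      simp only [Fin.lt_def, Fin.val_last]; omega
    simp [Fin.val_add_one_of_lt hl]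
  simp only [cnt, this, List.countP_map]
  congr 1
  funext a
  simp

theorem cnt_full {m : ℕ} (g : Fin m → Fin (m + 1)) (i : ℕ) :
    m ≤ cnt g i ↔ ∀ j, (g j : ℕ) + 1 ≤ i := by
  have h1 : cnt g i ≤ m := by
    simpa [len_pref, cnt] using List.countP_le_length (p := fun a => decide (a ≤ i)) (l := prefList g)
  have h2 : cnt g i = m ↔ ∀ a ∈ prefList g, a ≤ i := by
    have := List.countP_eq_length (p := fun a => decide (a ≤ i)) (l := prefList g)
    rw [len_pref] at this
    simpa [cnt] using this
  rw [show m ≤ cnt g i ↔ cnt g i = m by omega, h2]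
  constructor
  · intro h j
    exact h _ ((mem_pref g _).2 ⟨j, rfl⟩)
  · intro h a ha
    obtain ⟨j, rfl⟩ := (mem_pref g a).1 ha
    exact h j

theorem cnt_one {m : ℕ} (g : Fin m → Fin (m + 1)) :
    cnt g 1 = 0 ↔ ∀ j, (g j : ℕ) ≠ 0 := by
  simp only [cnt, List.countP_eq_zero, mem_pref]
  constructor
  · intro h j hj
    have := h _ ⟨j, rfl⟩
    simp [hj] at this
  · rintro h a ⟨j, rfl⟩
    simpa using h j

theorem aux_QZ {m : ℕ} (hm : 1 ≤ m) (g : Fin m → Fin (m + 1)) :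
    (∀ i ≤ m, i ≤ cnt g i) ↔
      ((∀ i ≤ m, i ≤ cnt (fun j => g j + 1) i + 1) ∧ cnt (fun j => g j + 1) 1 = 0) := by
  have hz : cnt (fun j => g j + 1) 1 = 0 ↔ ∀ j, (g j : ℕ) ≠ m := by
    rw [cnt_one]
    refine forall_congr' fun j => not_congr ?_
    rw [Fin.val_add_one]
    split_ifs with h
    · simp [h]
    · simp only [Nat.add_eq_zero_iff, one_ne_zero, and_false, false_iff]
      intro hc; exact h (Fin.ext hc)
  rw [hz]
  constructor
  · intro h
    have hl : ∀ j, (g j : ℕ) ≠ m := by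
      intro j
      have := (cnt_full g m).1 (h m le_rfl) j
      omega
    refine ⟨?_, hl⟩
    intro i hi
    cases i with
    | zero => omega
    | succ i =>
      rw [aux_shift g hl]
      have := h i (by omega)
      omega
  · rintro ⟨h, hl⟩ i hi
    rcases Nat.lt_or_ge i m with h1 | h1
    · have := h (i + 1) (by omega)
      rw [aux_shift g hl] at this
      omega
    · obtain rfl : i = m := by omega
      refine (cnt_full g _).2 fun j => ?_
      have := hl j
      have := (g j).isLt
      omega

theorem aux_L {m : ℕ} (hm : 1 ≤ m) (g : Fin m → Fin (m + 1)) :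
    flaws (m + 1) ((m + 1) :: prefList g) = 1 ↔
      ((∀ i ≤ m, i ≤ cnt g i + 1) ∧ ¬ ∀ i ≤ m, i ≤ cnt g i) := by
  have key : ∀ k, flaws (m + 1) ((m + 1) :: prefList g) ≤ k ↔ ∀ i ≤ m, i ≤ cnt g i + k := by
    intro k
    rw [aux_crit (m + 1) k _ (by simp [len_pref])]
    · have hf : m ≤ cnt g (m + 1) := (cnt_full g _).2 fun j => by have := (g j).isLt; omega
      constructor
      · intro h i hi
        have := h i (by omega)
        rw [List.countP_cons_of_neg (by simp; omega)] at this
        exact this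
      · intro h i hi
        rcases Nat.lt_or_ge i (m + 1) with h1 | h1
        · rw [List.countP_cons_of_neg (by simp; omega)]
          exact h i (by omega)
        · obtain rfl : i = m + 1 := by omega
          rw [List.countP_cons_of_pos (by simp)]
          unfold cnt at hf
          omega
    · intro a ha
      rcases List.mem_cons.1 ha with rfl | ha
      · omega
      · obtain ⟨j, rfl⟩ := (mem_pref g a).1 ha
        omega
  have k1 := key 1
  have k0 := key 0
  simp only [add_zero] at k0
  rw [← k1, ← k0]
  omega

theorem aux_R {m : ℕ} (hm : 1 ≤ m) (g : Fin m → Fin (m + 1)) :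
    flaws (m + 1) (2 :: prefList g) = 0 ↔
      ((∀ i ≤ m, i ≤ cnt g i + 1) ∧ ¬ cnt g 1 = 0) := by
  rw [← Nat.le_zero, aux_crit (m + 1) 0 _ (by simp [len_pref])]
  · have hf : m ≤ cnt g (m + 1) := (cnt_full g _).2 fun j => by have := (g j).isLt; omega
    constructor
    · intro h
      constructor
      · intro i hi
        have := h i (by omega)
        rw [List.countP_cons] at this
        unfold cnt
        split_ifs at this <;> omega
      · have := h 1 (by omega)
        rw [List.countP_cons_of_neg (by simp)] at this
        unfold cnt
        omega
    · rintro ⟨h, h1⟩ i hi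
      rcases Nat.lt_or_ge i 2 with h2 | h2
      · rw [List.countP_cons_of_neg (by simp; omega)]
        interval_cases i
        · omega
        · unfold cnt at h1; omega
      · rw [List.countP_cons_of_pos (by simpa using h2)]
        rcases Nat.lt_or_ge i (m + 1) with h3 | h3
        · have := h i (by omega)
          unfold cnt at this
          omega
        · obtain rfl : i = m + 1 := by omega
          unfold cnt at hf
          omega
  · intro a ha
    rcases List.mem_cons.1 ha with rfl | ha
    · omega
    · obtain ⟨j, rfl⟩ := (mem_pref g a).1 ha
      omega

/-- Theorem 6.5: `p^n_{n;1} = p^2_n` for `n ≥ 2`. -/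
theorem stmt13 (n : ℕ) (hn : 2 ≤ n) :
    pL n n n 1 n = pL n n n 0 2 := by
  classical
  obtain ⟨m, rfl⟩ : ∃ m, n = m + 1 := ⟨n - 1, by omega⟩
  have hm : 1 ≤ m := by omega
  have e1 := aux_pL m 1 (Fin.last m)
  have e2 := aux_pL m 0 ⟨1, by omega⟩
  simp only [Fin.val_last] at e1
  simp only [Nat.reduceAdd] at e2
  rw [e1, e2]
  simp only [aux_L hm, aux_R hm]
  set P : (Fin m → Fin (m + 1)) → Prop := fun g => ∀ i ≤ m, i ≤ cnt g i + 1 with hP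
  set Q : (Fin m → Fin (m + 1)) → Prop := fun g => ∀ i ≤ m, i ≤ cnt g i with hQ
  set Z : (Fin m → Fin (m + 1)) → Prop := fun g => cnt g 1 = 0 with hZ
  have s1 : (Finset.univ.filter (fun g => P g ∧ Q g)).card
      + (Finset.univ.filter (fun g => P g ∧ ¬ Q g)).card = (Finset.univ.filter P).card := by
    rw [← Finset.filter_filter, ← Finset.filter_filter]
    exact Finset.card_filter_add_card_filter_not _
  have s2 : (Finset.univ.filter (fun g => P g ∧ Z g)).card
      + (Finset.univ.filter (fun g => P g ∧ ¬ Z g)).card = (Finset.univ.filter P).card := by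
    rw [← Finset.filter_filter, ← Finset.filter_filter]
    exact Finset.card_filter_add_card_filter_not _
  have s3 : (Finset.univ.filter (fun g => P g ∧ Q g)).card
      = (Finset.univ.filter (fun g => P g ∧ Z g)).card := by
    refine Finset.card_bij (fun g _ => fun j => g j + 1) ?_ ?_ ?_
    · intro g hg
      simp only [Finset.mem_filter, Finset.mem_univ, true_and] at hg ⊢
      exact (aux_QZ hm g).1 hg.2
    · intro g _ g' _ h
      funext j
      exact add_right_cancel (congrFun h j)
    · intro g hg
      simp only [Finset.mem_filter, Finset.mem_univ, true_and] at hg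
      have hs : (fun j => (g j - 1) + 1) = g := by funext j; simp
      have hq : Q (fun j => g j - 1) := (aux_QZ hm _).2 (by rw [hs]; exact hg)
      refine ⟨fun j => g j - 1, ?_, hs⟩
      simp only [Finset.mem_filter, Finset.mem_univ, true_and]
      exact ⟨fun i hi => le_trans (hq i hi) (Nat.le_succ _), hq⟩
  have : (Finset.univ.filter (fun g => P g ∧ ¬ Q g)).card
      = (Finset.univ.filter (fun g => P g ∧ ¬ Z g)).card := by omega
  convert this using 2
end
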